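/- arXiv:math/0509439 — 2 statements merged into one kernel-verified Lean document; each statement's English description precedes it below -/
import Mathlib

section
/- Let (W,S) be a Coxeter system and n ≥ 0. Suppose A is a maximal (n+1)-spherical special subgroup of W (i.e., A is an (n+1)-spherical special subgroup not properly contained in any (n+1)-spherical special subgroup of W). If B is any (n+1)-spherical special subgroup of W such that A ⊆ wBw⁻¹ for some w ∈ W, then S_A = S_B. -/
open CoxeterSystem

namespace CoxFA

variable {B : Type*}

/-- The special subgroup of `W` generated by the simple reflections indexed by `T`. -/
def sp {W : Type*} [Group W] {M : CoxeterMatrix B} (cs : CoxeterSystem M W) (T : Set B) :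
    Subgroup W :=
  Subgroup.closure (cs.simple '' T)

/-- The conjugate subgroup `w H w⁻¹`. -/
def conjSub {W : Type*} [Group W] (w : W) (H : Subgroup W) : Subgroup W :=
  H.map (MulAut.conj w).toMonoidHom

/-- `(W_T, T)` is `n`-spherical: every special subgroup of `W_T` of rank at most `n`
is finite. -/
def IsSpherical {W : Type*} [Group W] {M : CoxeterMatrix B} (cs : CoxeterSystem M W)
    (n : ℕ) (T : Set B) : Prop :=
  ∀ U : Finset B, ↑U ⊆ T → U.card ≤ n → Finite ↥(sp cs (↑U : Set B))

/-- `W_T` is a maximal `n`-spherical special subgroup: it is `n`-spherical and is not properly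
contained in any `n`-spherical special subgroup. -/
def IsMaxSpherical {W : Type*} [Group W] {M : CoxeterMatrix B} (cs : CoxeterSystem M W)
    (n : ℕ) (T : Set B) : Prop :=
  IsSpherical cs n T ∧ ∀ T' : Set B, IsSpherical cs n T' → ¬ (sp cs T < sp cs T')

section ReflectionCocycle

variable {W : Type*} [Group W] {M : CoxeterMatrix B} (cs : CoxeterSystem M W)

open Classical in
/-- The permutation of `W × ZMod 2` given by conjugation by `s i` on the first factor, flipping the
sign of exactly the pairs whose first entry is `s i`. -/
noncomputable def signedConj (i : B) : Equiv.Perm (W × ZMod 2) :=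
  Function.Involutive.toPerm
    (fun p ↦ (cs.simple i * p.1 * cs.simple i, p.2 + if p.1 = cs.simple i then 1 else 0)) <| by
    rintro ⟨t, e⟩
    have h : cs.simple i * t * cs.simple i = cs.simple i ↔ t = cs.simple i := by
      rw [mul_eq_right, mul_eq_one_iff_inv_eq, cs.inv_simple, eq_comm]
    have h2 : ∀ a : ZMod 2, a + 1 + 1 = a := by decide
    ext
    · simp [mul_assoc]
    · by_cases ht : t = cs.simple i <;> simp [h, ht, h2]

open Classical in
theorem signedConj_apply (i : B) (p : W × ZMod 2) :
    signedConj cs i p =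
      (cs.simple i * p.1 * cs.simple i, p.2 + if p.1 = cs.simple i then 1 else 0) :=
  rfl

open Classical in
theorem prod_signedConj_apply (ω : List B) (t : W) (e : ZMod 2) :
    (ω.map (signedConj cs)).prod (t, e) =
      (cs.wordProd ω * t * (cs.wordProd ω)⁻¹, e + ((cs.rightInvSeq ω).count t : ZMod 2)) := by
  induction ω with
  | nil => simp
  | cons i ω ih =>
    have h : cs.wordProd ω * t * (cs.wordProd ω)⁻¹ = cs.simple i ↔
        (cs.wordProd ω)⁻¹ * cs.simple i * cs.wordProd ω = t := by
      constructor
      · intro h; rw [← h]; group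
      · intro h; rw [← h]; group
    rw [List.map_cons, List.prod_cons, Equiv.Perm.mul_apply, ih, signedConj_apply]
    ext
    · simp [cs.wordProd_cons, mul_assoc]
    · simp only [rightInvSeq, List.count_cons, h, beq_iff_eq]
      split_ifs <;> push_cast <;> ring

theorem getElem_leftInvSeq_alternatingWord_add (i j : B) (k : ℕ) (hk : k < M i j) :
    (cs.leftInvSeq (alternatingWord i j (2 * M i j)))[k + M i j]'(by simp; lia) =
      (cs.leftInvSeq (alternatingWord i j (2 * M i j)))[k]'(by simp; lia) := by
  rw [getElem_leftInvSeq_alternatingWord _ _ _ _ _ (by lia),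
    getElem_leftInvSeq_alternatingWord _ _ _ _ _ (by lia),
    cs.prod_alternatingWord_eq_mul_pow, cs.prod_alternatingWord_eq_mul_pow]
  have h1 : (2 * (k + M i j) + 1) / 2 = k + M i j := by lia
  have h2 : (2 * k + 1) / 2 = k := by lia
  rw [h1, h2, pow_add, cs.simple_mul_simple_pow']
  simp

open Classical in
theorem even_count_rightInvSeq_alternatingWord (i j : B) (t : W) :
    Even ((cs.rightInvSeq (alternatingWord i j (2 * M i j))).count t) := by
  have h : (cs.rightInvSeq (alternatingWord i j (2 * M i j))).count t =
      (cs.leftInvSeq (alternatingWord i j (2 * M i j)).reverse).count t := by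
    rw [cs.leftInvSeq_reverse, List.count_reverse]
  have h' : (alternatingWord i j (2 * M i j)).reverse = alternatingWord j i (2 * M j i) := by
    rw [M.symmetric j i]
    refine List.ext_getElem (by simp) fun n h1 h2 ↦ ?_
    rw [List.getElem_reverse]
    simp only [length_alternatingWord, List.length_reverse] at h1 h2 ⊢
    rw [getElem_alternatingWord _ _ _ _ (by lia), getElem_alternatingWord _ _ _ _ (by lia)]
    have : Even (2 * M i j + (2 * M i j - 1 - n)) ↔ ¬ Even (2 * M i j + n) := by
      rw [Nat.even_iff, Nat.even_iff]; lia
    simp only [this]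
    split_ifs <;> rfl
  rw [h, h']
  set l := cs.leftInvSeq (alternatingWord j i (2 * M j i)) with hl
  have hlen : l.length = 2 * M j i := by simp [hl]
  have hdrop : l.drop (M j i) = l.take (M j i) := by
    refine List.ext_getElem (by simp [hlen]; lia) fun n h1 h2 ↦ ?_
    simp only [List.length_drop, List.length_take, hlen] at h1 h2
    rw [List.getElem_drop, List.getElem_take]
    have := getElem_leftInvSeq_alternatingWord_add cs j i n (by lia)
    simp only [add_comm n] at this
    exact this
  rw [← List.take_append_drop (M j i) l, List.count_append, hdrop]
  exact Even.add_self _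

theorem isLiftable_signedConj : M.IsLiftable (signedConj cs) := by
  classical
  intro i j
  have hprod : ∀ m : ℕ, ((alternatingWord i j (2 * m)).map (signedConj cs)).prod =
      (signedConj cs i * signedConj cs j) ^ m := by
    intro m
    induction m with
    | zero => simp [alternatingWord]
    | succ m ih =>
      rw [show 2 * (m + 1) = 2 * m + 1 + 1 by ring, alternatingWord_succ, alternatingWord_succ]
      simp [ih, pow_succ]
  have hword : cs.wordProd (alternatingWord i j (2 * M i j)) = 1 := by
    rw [cs.prod_alternatingWord_eq_mul_pow]
    simp
  rw [← hprod]
  ext ⟨t, e⟩ : 1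
  rw [prod_signedConj_apply, hword,
    (ZMod.natCast_eq_zero_iff_even).2 (even_count_rightInvSeq_alternatingWord cs i j t)]
  simp

/-- The action of `W` on `W × ZMod 2` extending `signedConj`. -/
noncomputable def signedConjHom : W →* Equiv.Perm (W × ZMod 2) :=
  cs.lift ⟨signedConj cs, isLiftable_signedConj cs⟩

/-- The parity of the number of occurrences of `t` in the right inversion sequence of a word
for `w`. -/
noncomputable def invParity (w t : W) : ZMod 2 := (signedConjHom cs w (t, 0)).2

open Classical in
theorem signedConjHom_wordProd (ω : List B) (t : W) (e : ZMod 2) :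
    signedConjHom cs (cs.wordProd ω) (t, e) =
      (cs.wordProd ω * t * (cs.wordProd ω)⁻¹, e + ((cs.rightInvSeq ω).count t : ZMod 2)) := by
  rw [← prod_signedConj_apply, wordProd, map_list_prod, List.map_map]
  congr 3
  funext i
  exact cs.lift_apply_simple (isLiftable_signedConj cs) i

theorem signedConjHom_apply (w t : W) (e : ZMod 2) :
    signedConjHom cs w (t, e) = (w * t * w⁻¹, e + invParity cs w t) := by
  classical
  obtain ⟨ω, rfl⟩ := cs.wordProd_surjective w
  simp [invParity, signedConjHom_wordProd]

theorem invParity_mul (v w t : W) :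
    invParity cs (v * w) t = invParity cs w t + invParity cs v (w * t * w⁻¹) := by
  rw [invParity, map_mul, Equiv.Perm.mul_apply, signedConjHom_apply, signedConjHom_apply, zero_add]

theorem invParity_one (t : W) : invParity cs 1 t = 0 := by
  simp [invParity]

theorem invParity_simple_self (i : B) : invParity cs (cs.simple i) (cs.simple i) = 1 := by
  classical
  rw [invParity, ← cs.wordProd_singleton, signedConjHom_wordProd]
  simp

theorem invParity_self {t : W} (ht : cs.IsReflection t) : invParity cs t t = 1 := by
  obtain ⟨v, i, rfl⟩ := ht
  have h := invParity_mul cs v v⁻¹ (v * cs.simple i * v⁻¹)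
  have e1 : v⁻¹ * (v * cs.simple i * v⁻¹) * v⁻¹⁻¹ = cs.simple i := by group
  have e2 : cs.simple i * cs.simple i * (cs.simple i)⁻¹ = cs.simple i := by group
  rw [mul_inv_cancel, invParity_one, e1] at h
  rw [invParity_mul, e1, invParity_mul, invParity_simple_self, e2, add_left_comm, ← h, add_zero]

theorem isRightInversion_of_invParity_ne_zero {w t : W} (h : invParity cs w t ≠ 0) :
    cs.IsRightInversion w t := by
  classical
  obtain ⟨ω, hω, rfl⟩ := cs.exists_isReduced w
  refine cs.isRightInversion_of_mem_rightInvSeq hω ?_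
  by_contra hn
  rw [invParity, signedConjHom_wordProd, List.count_eq_zero_of_not_mem hn] at h
  simp at h

theorem isRightInversion_iff_invParity {w t : W} (ht : cs.IsReflection t) :
    cs.IsRightInversion w t ↔ invParity cs w t = 1 := by
  constructor
  · intro h
    by_contra hn
    have h0 : invParity cs w t = 0 := by
      revert hn; generalize invParity cs w t = a; revert a; decide
    have hwt : invParity cs (w * t) t ≠ 0 := by
      rw [invParity_mul, invParity_self cs ht, mul_inv_cancel_right, h0]
      decide
    exact (ht.isRightInversion_mul_left_iff.1 (isRightInversion_of_invParity_ne_zero cs hwt)) h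
  · intro h
    exact isRightInversion_of_invParity_ne_zero cs (by rw [h]; decide)

/-- A reflection is a left inversion of `v * z` iff it is a left inversion of exactly one of `v`
and `z`, after conjugating by `v` in the latter case. -/
theorem isLeftInversion_mul_iff {t : W} (ht : cs.IsReflection t) (v z : W) :
    cs.IsLeftInversion (v * z) t ↔
      ¬ (cs.IsLeftInversion v t ↔ cs.IsLeftInversion z (v⁻¹ * t * v)) := by
  have ht' : cs.IsReflection (v⁻¹ * t * v) := by simpa using ht.conj v⁻¹
  rw [← cs.isRightInversion_inv_iff, ← cs.isRightInversion_inv_iff, ← cs.isRightInversion_inv_iff,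
    isRightInversion_iff_invParity cs ht, isRightInversion_iff_invParity cs ht,
    isRightInversion_iff_invParity cs ht', mul_inv_rev, invParity_mul, inv_inv]
  generalize invParity cs v⁻¹ t = a
  generalize invParity cs z⁻¹ (v⁻¹ * t * v) = b
  revert a b
  decide

end ReflectionCocycle

section GeometricRepresentation

variable {W : Type*} [Group W] {M : CoxeterMatrix B}

open Module Polynomial.Chebyshev

/-- The simple coroot indexed by `i` in the geometric representation of `M`. -/
noncomputable def simpleCoroot (M : CoxeterMatrix B) (i : B) : Dual ℝ (B →₀ ℝ) :=
  Finsupp.linearCombination ℝ fun j ↦ -2 * Real.cos (Real.pi / M i j)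

theorem simpleCoroot_single (i j : B) :
    simpleCoroot M i (Finsupp.single j 1) = -2 * Real.cos (Real.pi / M i j) := by
  simp [simpleCoroot]

theorem simpleCoroot_single_self (i : B) : simpleCoroot M i (Finsupp.single i 1) = 2 := by
  simp [simpleCoroot_single]

/-- The reflection of the geometric representation of `M` indexed by `i`. -/
noncomputable def simpleReflection (M : CoxeterMatrix B) (i : B) : (B →₀ ℝ) ≃ₗ[ℝ] (B →₀ ℝ) :=
  reflection (simpleCoroot_single_self (M := M) i)

theorem sin_two_pi_div_pos {m : ℕ} (hm : 3 ≤ m) : 0 < Real.sin (2 * Real.pi / m) := by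
  have hm' : (3 : ℝ) ≤ m := by exact_mod_cast hm
  refine Real.sin_pos_of_pos_of_lt_pi (by positivity) ?_
  rw [div_lt_iff₀ (by positivity)]
  nlinarith [Real.pi_pos]

theorem eval_S_add_eval_S_eq_zero {m : ℕ} (hm : 3 ≤ m) {k : ℤ} (hk : 2 * k + 1 = m) :
    (S ℝ k).eval (2 * Real.cos (2 * Real.pi / m)) +
      (S ℝ (k - 1)).eval (2 * Real.cos (2 * Real.pi / m)) = 0 := by
  refine (mul_eq_zero_iff_right (sin_two_pi_div_pos hm).ne').1 ?_
  have hm0 : (m : ℝ) ≠ 0 := by positivity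
  have hk' : (m : ℝ) = 2 * k + 1 := by exact_mod_cast hk.symm
  have e : ((k : ℝ) + 1) * (2 * Real.pi / m) = 2 * Real.pi - k * (2 * Real.pi / m) := by
    field_simp
    rw [hk']
    ring
  rw [add_mul, S_two_mul_real_cos, S_two_mul_real_cos]
  push_cast
  rw [sub_add_cancel, e, Real.sin_two_pi_sub, neg_add_cancel]

theorem eval_S_eq_zero {m : ℕ} (hm : 3 ≤ m) {k : ℤ} (hk : 2 * (k + 1) = m) :
    (S ℝ k).eval (2 * Real.cos (2 * Real.pi / m)) = 0 := by
  refine (mul_eq_zero_iff_right (sin_two_pi_div_pos hm).ne').1 ?_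
  have hm0 : (m : ℝ) ≠ 0 := by positivity
  have hk' : (m : ℝ) = 2 * (k + 1) := by exact_mod_cast hk.symm
  have e : ((k : ℝ) + 1) * (2 * Real.pi / m) = Real.pi := by
    field_simp
    rw [hk']
    ring
  rw [S_two_mul_real_cos, e, Real.sin_pi]

theorem isLiftable_simpleReflection : M.IsLiftable (simpleReflection M) := by
  intro i j
  rcases eq_or_ne i j with rfl | hij
  · ext1 z
    simpa [simpleReflection, LinearEquiv.mul_apply] using
      involutive_reflection (simpleCoroot_single_self (M := M) i) z
  have h1 : M i j ≠ 1 := M.off_diagonal i j hij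
  have ht : 2 * Real.cos (2 * Real.pi / M i j) =
      simpleCoroot M i (Finsupp.single j 1) * simpleCoroot M j (Finsupp.single i 1) - 2 := by
    rw [simpleCoroot_single, simpleCoroot_single, M.symmetric j i, mul_div_assoc, Real.cos_two_mul]
    ring
  ext1 z
  rw [simpleReflection, simpleReflection, reflection_mul_reflection_pow_apply _ _ _ _ _ ht,
    LinearEquiv.coe_one, id]
  rcases (by lia : M i j = 0 ∨ M i j = 2 ∨ 3 ≤ M i j) with h | h | h
  · simp [h]
  · have e1 : simpleCoroot M i (Finsupp.single j 1) = 0 := by simp [simpleCoroot_single, h]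
    have e2 : simpleCoroot M j (Finsupp.single i 1) = 0 := by
      simp [simpleCoroot_single, M.symmetric j i, h]
    simp only [h, e1, e2]
    norm_num
    module
  · rcases Nat.even_or_odd' (M i j) with ⟨k, hk | hk⟩
    · have hS := eval_S_eq_zero h (k := (k : ℤ) - 1) (by lia)
      rw [show ((M i j : ℤ) - 2) / 2 = k - 1 by lia, show ((M i j : ℤ) - 1) / 2 = k - 1 by lia, hS]
      simp
    · have hS := eval_S_add_eval_S_eq_zero h (k := (k : ℤ)) (by lia)
      rw [show ((M i j : ℤ) - 2) / 2 = k - 1 by lia, show ((M i j : ℤ) - 1) / 2 = k by lia,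
        show ((M i j : ℤ) - 3) / 2 = k - 1 by lia, show (M i j : ℤ) / 2 = k by lia, hS]
      simp

theorem mem_of_simple_mem_sp (cs : CoxeterSystem M W) {T : Set B} {i : B}
    (h : cs.simple i ∈ sp cs T) : i ∈ T := by
  by_contra hi
  have key : ∀ w ∈ sp cs T, ∀ v : B →₀ ℝ,
      cs.lift ⟨simpleReflection M, isLiftable_simpleReflection⟩ w v i = v i := by
    intro w hw
    induction hw using Subgroup.closure_induction with
    | mem x hx =>
      obtain ⟨j, hj, rfl⟩ := hx
      intro v
      have hji : j ≠ i := fun h ↦ hi (h ▸ hj)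
      rw [cs.lift_apply_simple isLiftable_simpleReflection]
      simp [simpleReflection, reflection_apply, hji]
    | one => simp
    | mul x y _ _ hx hy =>
      intro v
      rw [map_mul, LinearEquiv.mul_apply, hx, hy]
    | inv x _ hx =>
      intro v
      rw [← hx, ← LinearEquiv.mul_apply, ← map_mul]
      simp
  have h1 := key _ h (Finsupp.single i 1)
  rw [cs.lift_apply_simple isLiftable_simpleReflection, simpleReflection,
    reflection_apply_self] at h1
  norm_num at h1

theorem subset_of_sp_le_sp (cs : CoxeterSystem M W) {T T' : Set B} (h : sp cs T ≤ sp cs T') :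
    T ⊆ T' :=
  fun _ hi ↦ mem_of_simple_mem_sp cs (h (Subgroup.subset_closure ⟨_, hi, rfl⟩))

end GeometricRepresentation

section CosetRepresentatives

variable {W : Type*} [Group W] {M : CoxeterMatrix B} (cs : CoxeterSystem M W)

theorem simple_mem_sp {T : Set B} {i : B} (hi : i ∈ T) : cs.simple i ∈ sp cs T :=
  Subgroup.subset_closure ⟨i, hi, rfl⟩

theorem sp_induction_left {T : Set B} {p : W → Prop} (one : p 1)
    (mul : ∀ i ∈ T, ∀ x ∈ sp cs T, p x → p (cs.simple i * x)) {x : W} (hx : x ∈ sp cs T) :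
    p x := by
  induction hx using Subgroup.closure_induction_left with
  | one => exact one
  | mul_left x hx y hy h =>
    obtain ⟨i, hi, rfl⟩ := hx
    exact mul i hi y hy h
  | inv_mul_cancel x hx y hy h =>
    obtain ⟨i, hi, rfl⟩ := hx
    rw [cs.inv_simple]
    exact mul i hi y hy h

theorem length_mul_of_forall_length_le {T : Set B} {w : W}
    (hw : ∀ x ∈ sp cs T, cs.length w ≤ cs.length (x * w)) {x : W} (hx : x ∈ sp cs T) :
    cs.length (x * w) = cs.length x + cs.length w := by
  refine sp_induction_left cs (p := fun x ↦ cs.length (x * w) = cs.length x + cs.length w)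
    (by simp) ?_ hx
  · intro i hi x hx ih
    have hs := simple_mem_sp cs hi
    have h := isLeftInversion_mul_iff cs (cs.isReflection_simple i) x w
    have hn : ¬ cs.IsLeftInversion w (x⁻¹ * cs.simple i * x) := fun h ↦
      (hw _ (mul_mem (mul_mem (inv_mem hx) hs) hx)).not_gt h.2
    simp only [hn, iff_false, not_not, cs.isLeftInversion_simple_iff_isLeftDescent,
      IsLeftDescent] at h
    rw [mul_assoc]
    rcases cs.length_simple_mul x i with h1 | h1 <;>
      rcases cs.length_simple_mul (x * w) i with h2 | h2 <;> lia

/-- The exchange condition. -/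
theorem exists_eraseIdx_of_isLeftDescent {ω : List B} {i : B}
    (h : cs.IsLeftDescent (cs.wordProd ω) i) :
    ∃ k < ω.length, cs.wordProd (ω.eraseIdx k) = cs.simple i * cs.wordProd ω := by
  classical
  have hinv := (cs.isLeftInversion_simple_iff_isLeftDescent _ i).2 h
  rw [← cs.isRightInversion_inv_iff, ← cs.wordProd_reverse,
    isRightInversion_iff_invParity cs (cs.isReflection_simple i), invParity,
    signedConjHom_wordProd, cs.rightInvSeq_reverse, List.count_reverse, zero_add] at hinv
  have hmem : cs.simple i ∈ cs.leftInvSeq ω := by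
    by_contra hn
    rw [List.count_eq_zero_of_not_mem hn] at hinv
    simp at hinv
  obtain ⟨k, hk, hki⟩ := List.getElem_of_mem hmem
  refine ⟨k, by simpa using hk, ?_⟩
  rw [← cs.getD_leftInvSeq_mul_wordProd, List.getD_eq_getElem _ _ hk, hki]

theorem exists_isReduced_of_mem_sp {T : Set B} {v : W} (hv : v ∈ sp cs T) :
    ∃ ω : List B, cs.IsReduced ω ∧ (∀ i ∈ ω, i ∈ T) ∧ cs.wordProd ω = v := by
  refine sp_induction_left cs
    (p := fun v ↦ ∃ ω : List B, cs.IsReduced ω ∧ (∀ i ∈ ω, i ∈ T) ∧ cs.wordProd ω = v)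
    ⟨[], by simp [CoxeterSystem.IsReduced], by simp, by simp⟩ ?_ hv
  rintro j hj _ - ⟨ω, hω, hωT, rfl⟩
  rcases cs.length_simple_mul (cs.wordProd ω) j with h | h
  · refine ⟨j :: ω, ?_, by simpa using ⟨hj, hωT⟩, cs.wordProd_cons j ω⟩
    rw [CoxeterSystem.IsReduced, cs.wordProd_cons, h, hω.eq, List.length_cons]
  · obtain ⟨k, hk, hkω⟩ := exists_eraseIdx_of_isLeftDescent cs (cs.isLeftDescent_iff.2 h)
    refine ⟨ω.eraseIdx k, ?_, fun i hi ↦ hωT i (List.mem_of_mem_eraseIdx hi), hkω⟩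
    rw [CoxeterSystem.IsReduced, hkω, List.length_eraseIdx_of_lt hk]
    have := hω.eq
    lia

/-- If `s i` shortens `x * w` for every `x` in `W_T`, then every element of the special subgroup
generated by `T` and `i` is a prefix of some such `x * w`. -/
theorem exists_length_add_length_inv_mul_eq {T : Set B} {w : W} {i : B}
    (hi : ∀ x ∈ sp cs T, cs.IsLeftDescent (x * w) i) {v : W} (hv : v ∈ sp cs (insert i T)) :
    ∃ x ∈ sp cs T, cs.length v + cs.length (v⁻¹ * (x * w)) = cs.length (x * w) := by
  obtain ⟨ω, hω, hωT, rfl⟩ := exists_isReduced_of_mem_sp cs hv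
  clear hv
  induction ω with
  | nil => exact ⟨1, one_mem _, by simp⟩
  | cons j ω ih =>
    have hω' : cs.IsReduced ω := hω.drop 1
    obtain ⟨x, hx, hxv⟩ := ih hω' fun k hk ↦ hωT k (List.mem_cons_of_mem _ hk)
    have hlen : cs.length (cs.simple j * cs.wordProd ω) = cs.length (cs.wordProd ω) + 1 := by
      rw [← cs.wordProd_cons, hω.eq, hω'.eq, List.length_cons]
    rw [cs.wordProd_cons]
    generalize cs.wordProd ω = v at hxv hlen
    by_cases hj : cs.IsLeftDescent (x * w) j
    · refine ⟨x, hx, ?_⟩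
      have h := isLeftInversion_mul_iff cs (cs.isReflection_simple j) v (v⁻¹ * (x * w))
      have hn : ¬ cs.IsLeftDescent v j := cs.not_isLeftDescent_iff.2 hlen
      rw [mul_inv_cancel_left, cs.isLeftInversion_simple_iff_isLeftDescent,
        cs.isLeftInversion_simple_iff_isLeftDescent] at h
      simp only [hj, hn, false_iff, not_not, true_iff] at h
      have h1 := h.2
      have e : v⁻¹ * cs.simple j * v * (v⁻¹ * (x * w)) =
          (cs.simple j * v)⁻¹ * (x * w) := by
        rw [mul_inv_rev, cs.inv_simple]; group
      rw [e] at h1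
      have h2 := cs.length_mul_le (cs.simple j * v) ((cs.simple j * v)⁻¹ * (x * w))
      rw [mul_inv_cancel_left] at h2
      lia
    · have hjT : j ∈ T := (hωT j List.mem_cons_self).resolve_left fun h ↦ hj (h ▸ hi x hx)
      refine ⟨cs.simple j * x, mul_mem (simple_mem_sp cs hjT) hx, ?_⟩
      have h1 := cs.not_isLeftDescent_iff.1 hj
      have e : (cs.simple j * v)⁻¹ * (cs.simple j * x * w) = v⁻¹ * (x * w) := by group
      rw [e, mul_assoc]
      lia

theorem finite_of_length_le [Finite B] (H : Subgroup W) (C : ℕ)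
    (hH : ∀ v ∈ H, cs.length v ≤ C) : Finite H := by
  refine ((List.finite_length_le B C).image cs.wordProd).subset fun v hv ↦ ?_
  obtain ⟨ω, hω, rfl⟩ := cs.exists_isReduced v
  exact ⟨ω, by simpa [← hω.eq] using hH _ hv, rfl⟩

theorem finite_sp_insert [Finite B] {T : Set B} {w : W} {i : B} [Finite (sp cs T)]
    (hi : ∀ x ∈ sp cs T, cs.IsLeftDescent (x * w) i) : Finite (sp cs (insert i T)) := by
  obtain ⟨C, hC⟩ := (Set.finite_range fun x : sp cs T ↦ cs.length (x * w)).bddAbove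
  refine finite_of_length_le cs _ C fun v hv ↦ ?_
  obtain ⟨x, hx, h⟩ := exists_length_add_length_inv_mul_eq cs hi hv
  have := hC ⟨⟨x, hx⟩, rfl⟩
  simp only at this
  lia

theorem sp_mono {T T' : Set B} (h : T ⊆ T') : sp cs T ≤ sp cs T' :=
  Subgroup.closure_mono (Set.image_mono h)

theorem isSpherical_insert [Finite B] {n : ℕ} {T : Set B} {w : W} {i : B}
    (hT : IsSpherical cs n T)
    (hi : ∀ x ∈ sp cs T, cs.IsLeftDescent (x * w) i) : IsSpherical cs n (insert i T) := by
  classical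
  intro U hU hcard
  have hsub : ((U.erase i : Finset B) : Set B) ⊆ T := by
    intro j hj
    simp only [Finset.coe_erase, Set.mem_sdiff, Set.mem_singleton_iff] at hj
    exact (hU hj.1).resolve_left hj.2
  have := hT (U.erase i) hsub ((Finset.card_le_card (Finset.erase_subset i U)).trans hcard)
  have hfin := finite_sp_insert cs fun x hx ↦ hi x (sp_mono cs hsub hx)
  refine Finite.Set.subset (sp cs (insert i ((U.erase i : Finset B) : Set B)) : Set W)
    (sp_mono cs ?_)
  intro j hj
  by_cases h : j = i <;> simp_all

end CosetRepresentatives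

/-- If `A = W_{S_A}` is a maximal `(n+1)`-spherical special subgroup of `W`,
`B = W_{S_B}` is an `(n+1)`-spherical special subgroup, and `A ⊆ w B w⁻¹` for some `w ∈ W`,
then `S_A = S_B`. -/
theorem stmt_12 {W : Type*} [Group W] [Fintype B] {M : CoxeterMatrix B}
    (cs : CoxeterSystem M W) (n : ℕ) (SA SB : Set B)
    (hA : IsMaxSpherical cs (n + 1) SA) (hB : IsSpherical cs (n + 1) SB)
    (w : W) (hsub : sp cs SA ≤ conjSub w (sp cs SB)) :
    SA = SB := by
  classical
  have hne : ∃ k, ∃ w : W, (∀ x ∈ sp cs SA, w⁻¹ * x * w ∈ sp cs SB) ∧ cs.length w = k := by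
    refine ⟨_, w, fun x hx ↦ ?_, rfl⟩
    obtain ⟨y, hy, rfl⟩ := hsub hx
    simpa [mul_assoc] using hy
  obtain ⟨w, hAB, hlen⟩ := Nat.find_spec hne
  have hmin : ∀ w' : W, (∀ x ∈ sp cs SA, w'⁻¹ * x * w' ∈ sp cs SB) →
      cs.length w ≤ cs.length w' := fun w' hw' ↦ hlen ▸ Nat.find_min' hne ⟨w', hw', rfl⟩
  have hl : ∀ x ∈ sp cs SA, cs.length w ≤ cs.length (x * w) := by
    refine fun x hx ↦ hmin _ fun y hy ↦ ?_
    have := hAB _ (mul_mem (mul_mem (inv_mem hx) hy) hx)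
    simpa [mul_assoc] using this
  have hr : ∀ y ∈ sp cs SB, cs.length w ≤ cs.length (w * y) := by
    refine fun y hy ↦ hmin _ fun x hx ↦ ?_
    have := mul_mem (mul_mem (inv_mem hy) (hAB x hx)) hy
    simpa [mul_assoc] using this
  have hl' : ∀ x ∈ sp cs SA, cs.length (x * w) = cs.length x + cs.length w :=
    fun x hx ↦ length_mul_of_forall_length_le cs hl hx
  have hr' : ∀ y ∈ sp cs SB, cs.length (w * y) = cs.length w + cs.length y := by
    intro y hy
    have := length_mul_of_forall_length_le cs (T := SB) (w := w⁻¹) (fun x hx ↦ by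
      simpa [← cs.length_inv (x * w⁻¹)] using hr _ (inv_mem hx)) (inv_mem hy)
    rw [← mul_inv_rev, cs.length_inv, cs.length_inv, cs.length_inv] at this
    lia
  have hw1 : w = 1 := by
    by_contra hne1
    obtain ⟨i, hi⟩ := cs.exists_leftDescent_of_ne_one hne1
    have hdesc : ∀ x ∈ sp cs SA, cs.IsLeftDescent (x * w) i := by
      intro x hx
      have h1 := hl' x hx
      have h2 := hr' _ (hAB x hx)
      have h3 := cs.length_mul_le (cs.simple i * w) (w⁻¹ * x * w)
      have e1 : w * (w⁻¹ * x * w) = x * w := by group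
      have e2 : cs.simple i * w * (w⁻¹ * x * w) = cs.simple i * (x * w) := by group
      rw [e1] at h2
      rw [e2] at h3
      unfold IsLeftDescent at hi ⊢
      lia
    have hle := sp_mono cs (Set.subset_insert i SA)
    have heq := eq_of_le_of_not_lt hle (hA.2 _ (isSpherical_insert cs hA.1 hdesc))
    exact (hl _ (heq ▸ simple_mem_sp cs (Set.mem_insert i SA))).not_gt hi
  subst hw1
  have hle : sp cs SA ≤ sp cs SB := fun x hx ↦ by simpa using hAB x hx
  have heq := eq_of_le_of_not_lt hle (hA.2 _ hB)
  exact (subset_of_sp_le_sp cs hle).antisymm (subset_of_sp_le_sp cs heq.ge)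

end CoxFA
end

section
/- Let (W,S) be a Coxeter system and let Q be a finite poset. Suppose G(Q) assigns to each σ ∈ Q a special subgroup G_σ of W such that G_σ ⊆ G_τ whenever τ < σ, and the structure maps are the inclusion homomorphisms. Assume: (i) for each s ∈ S, the set Q_s = {σ ∈ Q : s ∈ G_σ} is nonempty and connected, in the sense that any two elements of Q_s are joined by a sequence of elements of Q_s in which consecutive elements are comparable in Q; and (ii) for all s, t ∈ S with m_{s,t} < ∞, there exists σ ∈ Q with {s,t} ⊆ G_σ. Then W, equipped with the inclusion homomorphisms G_σ ↪ W, is the colimit of the diagram of groups G(Q): for any group H and any family of homomorphisms f_σ : G_σ → H commuting with the inclusions, there is a unique homomorphism f : W → H with f ∘ (G_σ ↪ W) = f_σ for all σ. -/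
open CoxeterSystem

namespace CoxFA

variable {B : Type*}

/-- If a simple complex of special subgroups of `W` over a finite poset `Q`
(with inclusions as structure maps) satisfies: (i) for each `s ∈ S` the set of `σ ∈ Q` with
`s ∈ G_σ` is nonempty and connected via comparability chains, and (ii) any two generators
`s, t` with `m_{s,t} < ∞` lie in a common local group, then `W` together with the inclusions
`G_σ ↪ W` is the colimit of the diagram of groups. -/
theorem stmt_14 {W : Type*} [Group W] [Fintype B] {M : CoxeterMatrix B}
    (cs : CoxeterSystem M W) {Q : Type*} [PartialOrder Q] [Fintype Q]
    (T : Q → Set B)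
    (hmono : ∀ {τ σ : Q}, τ < σ → sp cs (T σ) ≤ sp cs (T τ))
    (hconn : ∀ s : B, (∃ σ : Q, cs.simple s ∈ sp cs (T σ)) ∧
      ∀ σ τ : Q, cs.simple s ∈ sp cs (T σ) → cs.simple s ∈ sp cs (T τ) →
        Relation.ReflTransGen
          (fun u v => cs.simple s ∈ sp cs (T u) ∧ cs.simple s ∈ sp cs (T v) ∧
            (u ≤ v ∨ v ≤ u)) σ τ)
    (hpair : ∀ s u : B, M s u ≠ 0 →
      ∃ σ : Q, cs.simple s ∈ sp cs (T σ) ∧ cs.simple u ∈ sp cs (T σ))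
    {H : Type*} [Group H] (f : ∀ σ : Q, ↥(sp cs (T σ)) →* H)
    (hf : ∀ (τ σ : Q) (h : τ < σ) (x : W) (hx : x ∈ sp cs (T σ)),
      f τ ⟨x, hmono h hx⟩ = f σ ⟨x, hx⟩) :
    ∃! F : W →* H, ∀ (σ : Q) (x : W) (hx : x ∈ sp cs (T σ)), F x = f σ ⟨x, hx⟩ := by
  have hindep : ∀ (s : B) (σ τ : Q) (hσ : cs.simple s ∈ sp cs (T σ))
      (hτ : cs.simple s ∈ sp cs (T τ)), f σ ⟨_, hσ⟩ = f τ ⟨_, hτ⟩ := by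
    intro s σ τ hσ hτ
    have h := (hconn s).2 σ τ hσ hτ
    induction h with
    | refl => rfl
    | tail _ hstep ih =>
      obtain ⟨hu, hv, huv⟩ := hstep
      rw [ih hu]
      rcases huv with h | h
      · rcases h.eq_or_lt with rfl | h
        · rfl
        · exact hf _ _ h _ hv
      · rcases h.eq_or_lt with rfl | h
        · rfl
        · exact (hf _ _ h _ hu).symm
  choose σ₀ hσ₀ using fun s => (hconn s).1
  have hlift : M.IsLiftable fun s => f (σ₀ s) ⟨cs.simple s, hσ₀ s⟩ := by
    intro s u
    by_cases hM : M s u = 0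
    · rw [hM, pow_zero]
    · obtain ⟨σ, hs, hu⟩ := hpair s u hM
      dsimp only
      rw [hindep s _ σ _ hs, hindep u _ σ _ hu, ← map_mul, ← map_pow]
      have h1 : ((⟨cs.simple s, hs⟩ : sp cs (T σ)) * ⟨cs.simple u, hu⟩) ^ M s u = 1 :=
        Subtype.ext (cs.simple_mul_simple_pow s u)
      rw [h1, map_one]
  refine ⟨cs.lift ⟨_, hlift⟩, ?_, ?_⟩
  · intro σ x hx
    induction hx using Subgroup.closure_induction with
    | mem x hx =>
      obtain ⟨s, hs, rfl⟩ := hx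
      rw [cs.lift_apply_simple hlift]
      exact hindep s _ σ _ _
    | one => rw [map_one]; exact (map_one (f σ)).symm
    | mul x y hx hy ihx ihy =>
      rw [map_mul, ihx, ihy]
      exact (map_mul (f σ) ⟨x, hx⟩ ⟨y, hy⟩).symm
    | inv x hx ih =>
      rw [map_inv, ih]
      exact (map_inv (f σ) ⟨x, hx⟩).symm
  · intro F hF
    refine cs.ext_simple fun s => ?_
    rw [cs.lift_apply_simple hlift]
    exact hF _ _ _

end CoxFA
end
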